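/- arXiv:2304.13196 — 2 statements merged into one kernel-verified Lean document; each statement's English description precedes it below -/
import Mathlib

section
/- Let F be a free group of finite rank n, let r be a prime, and let R be a finite-index normal subgroup of F. Let x ∈ F be an element whose image under the mod-r abelianization F → (ℤ/r)^n is nonzero, and let m be the smallest positive integer with x^m ∈ R. Then the image of x^m in Abelianization(R) ⊗_ℤ (ℤ/r) is nonzero. -/
open scoped TensorProduct

/-- The mod-r abelianization of the free group on n generators. -/
def freeModAb (n r : ℕ) : FreeGroup (Fin n) →* Multiplicative (Fin n → ZMod r) :=
  FreeGroup.lift fun i => Multiplicative.ofAdd (Pi.single i (1 : ZMod r))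

theorem tensor_ne_of_hom {G : Type*} [Group G] (r : ℕ) (f : G →* Multiplicative (ZMod r)) (y : G)
    (hy : f y ≠ 1) :
    ((1 : ZMod r) ⊗ₜ[ℤ] Additive.ofMul (Abelianization.of y) :
      ZMod r ⊗[ℤ] Additive (Abelianization G)) ≠ 0 := by
  intro h
  apply hy
  let g : Additive (Abelianization G) →ₗ[ℤ] ZMod r :=
    (MonoidHom.toAdditiveLeft (Abelianization.lift f)).toIntLinearMap
  have h2 := congrArg (TensorProduct.lift ((LinearMap.mul ℤ (ZMod r)).compl₂ g)) h
  have h3 : g (Additive.ofMul (Abelianization.of y)) = 0 := by simpa using h2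
  exact h3

/-- In a subgroup of a free group all of whose elements map into powers of `x` modulo `R`,
the exponent lifts to an integer valued homomorphism. -/
theorem exists_exponent {α : Type} (R : Subgroup (FreeGroup α)) [R.Normal] (x : FreeGroup α) :
    ∃ Q : ((Subgroup.zpowers (QuotientGroup.mk' R x)).comap (QuotientGroup.mk' R)) →*
      Multiplicative ℤ, ∀ h, QuotientGroup.mk' R (Subtype.val h) =
        (QuotientGroup.mk' R x) ^ (Multiplicative.toAdd (Q h)) := by
  set H := (Subgroup.zpowers (QuotientGroup.mk' R x)).comap (QuotientGroup.mk' R) with hH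
  have hk : ∀ h : H, ∃ k : ℤ, (QuotientGroup.mk' R x) ^ k = QuotientGroup.mk' R h := fun h =>
    Subgroup.mem_zpowers_iff.1 (Subgroup.mem_comap.1 h.2)
  choose k hk using hk
  let Q : H →* Multiplicative ℤ :=
    IsFreeGroup.lift (fun i => Multiplicative.ofAdd (k (IsFreeGroup.of i)))
  refine ⟨Q, fun h => ?_⟩
  have : (QuotientGroup.mk' R).comp H.subtype =
      (zpowersHom _ (QuotientGroup.mk' R x)).comp Q := by
    apply IsFreeGroup.ext_hom
    intro i
    simp only [MonoidHom.comp_apply, Q, IsFreeGroup.lift_of, zpowersHom_apply, toAdd_ofAdd, hk]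
    rfl
  exact DFunLike.congr_fun this h

/-- Lemma (stability of r-nontriviality, free case): if x is nonzero in H₁(F_n; ℤ/r) and m
is minimal positive with x^m ∈ R, then the image of x^m in Abelianization(R) ⊗ ℤ/r is
nonzero. -/
theorem elevation_nonzero_mod_r_free (n : ℕ) (r : ℕ) (hr : r.Prime)
    (R : Subgroup (FreeGroup (Fin n))) [R.Normal] (hfi : R.FiniteIndex)
    (x : FreeGroup (Fin n)) (hx : freeModAb n r x ≠ 1)
    (m : ℕ) (hm : 0 < m) (hxm : x ^ m ∈ R)
    (hmin : ∀ m' : ℕ, 0 < m' → x ^ m' ∈ R → m ≤ m') :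
    ((1 : ZMod r) ⊗ₜ[ℤ] Additive.ofMul (Abelianization.of (⟨x ^ m, hxm⟩ : ↥R)) :
      ZMod r ⊗[ℤ] Additive (Abelianization ↥R)) ≠ 0 := by
  have : Fact r.Prime := ⟨hr⟩
  by_cases hrm : r ∣ m
  · obtain ⟨Q, hQ⟩ := exists_exponent R x
    have mem_iff : ∀ y : FreeGroup (Fin n), QuotientGroup.mk' R y = 1 ↔ y ∈ R := fun y =>
      QuotientGroup.eq_one_iff y
    have hmord : m = orderOf (QuotientGroup.mk' R x) := by
      have hd : orderOf (QuotientGroup.mk' R x) ∣ m := by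
        apply orderOf_dvd_of_pow_eq_one
        rw [← map_pow, mem_iff]; exact hxm
      apply le_antisymm
      · apply hmin _ (Nat.pos_of_dvd_of_pos hd hm)
        rw [← mem_iff, map_pow, pow_orderOf_eq_one]
      · exact Nat.le_of_dvd hm hd
    have hle : R ≤ (Subgroup.zpowers (QuotientGroup.mk' R x)).comap (QuotientGroup.mk' R) := by
      intro y hy
      rw [Subgroup.mem_comap, (mem_iff y).2 hy]
      exact one_mem _
    let P : R →* Multiplicative ℤ := Q.comp (Subgroup.inclusion hle)
    have hP : ∀ y : R, (m : ℤ) ∣ Multiplicative.toAdd (P y) := by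
      intro y
      rw [hmord, orderOf_dvd_iff_zpow_eq_one]
      exact (hQ (Subgroup.inclusion hle y)).symm.trans ((mem_iff _).2 y.2)
    let f : R →* Multiplicative (ZMod r) := MonoidHom.mk'
      (fun y => Multiplicative.ofAdd ((Multiplicative.toAdd (P y) / (m : ℤ) : ℤ) : ZMod r)) (by
        intro a b
        rw [map_mul, toAdd_mul, Int.add_ediv_of_dvd_left (hP a), Int.cast_add, ofAdd_add])
    apply tensor_ne_of_hom r f
    let x' : (Subgroup.zpowers (QuotientGroup.mk' R x)).comap (QuotientGroup.mk' R) :=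
      ⟨x, Subgroup.mem_comap.2 (Subgroup.mem_zpowers _)⟩
    have hx' : (m : ℤ) ∣ Multiplicative.toAdd (Q x') - 1 := by
      rw [hmord, orderOf_dvd_iff_zpow_eq_one, zpow_sub, ← hQ x', zpow_one]
      exact mul_inv_cancel _
    have hPx : Multiplicative.toAdd (P ⟨x ^ m, hxm⟩) = m * Multiplicative.toAdd (Q x') := by
      have : Subgroup.inclusion hle ⟨x ^ m, hxm⟩ = x' ^ m := rfl
      simp only [P, MonoidHom.comp_apply, this, map_pow, toAdd_pow, nsmul_eq_mul]
    intro h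
    have h1 : ((Multiplicative.toAdd (P ⟨x ^ m, hxm⟩) / (m : ℤ) : ℤ) : ZMod r) = 0 := h
    rw [hPx, Int.mul_ediv_cancel_left _ (by exact_mod_cast hm.ne'),
      ZMod.intCast_zmod_eq_zero_iff_dvd] at h1
    have h2 : (r : ℤ) ∣ Multiplicative.toAdd (Q x') - 1 :=
      (Int.natCast_dvd_natCast.2 hrm).trans hx'
    have h3 : (r : ℤ) ∣ 1 := by simpa using dvd_sub h1 h2
    have h4 : r ∣ 1 := by exact_mod_cast h3
    exact hr.one_lt.ne' (Nat.dvd_one.1 h4)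
  · obtain ⟨i, hi⟩ : ∃ i, Multiplicative.toAdd (freeModAb n r x) i ≠ 0 := by
      by_contra! hcon
      exact hx (congrArg Multiplicative.ofAdd (funext hcon))
    let f : R →* Multiplicative (ZMod r) :=
      ((AddMonoidHom.toMultiplicative (Pi.evalAddMonoidHom (fun _ : Fin n => ZMod r) i)).comp
        (freeModAb n r)).comp R.subtype
    apply tensor_ne_of_hom r f
    intro h
    have h1 : Multiplicative.toAdd (freeModAb n r (x ^ m)) i = 0 := h
    rw [map_pow, toAdd_pow, Pi.smul_apply, nsmul_eq_mul, mul_eq_zero,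
      ZMod.natCast_eq_zero_iff] at h1
    exact h1.elim hrm hi
end

section
/- Let n ≥ 1, let r be a prime, and let k be a positive integer with r^k > (n−1)(r−1). Then there exist a finite group G whose order is a power of r, a subgroup C of G contained in the center of G, and group homomorphisms ρ : F_n → G, α : G → (ℤ/r)^n, and Ψ : C → ℤ/r such that: (1) the composition α ∘ ρ equals the mod-r abelianization F_n → (ℤ/r)^n; and (2) for every g ∈ G with α(g) ≠ 0, the element g^{r^k} lies in C and Ψ(g^{r^k}) ≠ 0. -/
namespace SpecialP

/-- In a finite group a submonoid is a subgroup. -/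
def toSub {P : Type} [Group P] [Finite P] (S : Submonoid P) : Subgroup P where
  toSubmonoid := S
  inv_mem' := by
    intro x hx
    have h : x⁻¹ = x ^ (orderOf x - 1) := by
      rw [inv_eq_iff_mul_eq_one, ← pow_succ', Nat.sub_add_cancel (orderOf_pos x), pow_orderOf_eq_one]
    rw [h]
    exact S.pow_mem hx _

section poly
variable {n r : ℕ}

/-- Functions given by homogeneous polynomials of degree `d`. -/
def V (n r d : ℕ) : Submodule (ZMod r) ((Fin n → ZMod r) → ZMod r) :=
  Submodule.span (ZMod r) (Set.range fun (w : Fin d → Fin n) (a : Fin n → ZMod r) => ∏ t, a (w t))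

lemma V_mul {d : ℕ} {g : (Fin n → ZMod r) → ZMod r} (hg : g ∈ V n r d) (j : Fin n) :
    (fun a => g a * a j) ∈ V n r (d + 1) := by
  unfold V at hg
  induction hg using Submodule.span_induction with
  | mem x hx =>
    obtain ⟨w, rfl⟩ := hx
    refine Submodule.subset_span ⟨Fin.snoc (α := fun _ => Fin n) w j, ?_⟩
    funext a
    simp [Fin.prod_univ_castSucc]
  | zero =>
    simp only [Pi.zero_apply, zero_mul]
    exact (V n r (d+1)).zero_mem
  | add x y _ _ hx hy =>
    convert (V n r (d+1)).add_mem hx hy using 1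
    funext a
    simp [add_mul]
  | smul c x _ hx =>
    convert (V n r (d+1)).smul_mem c hx using 1
    funext a
    simp [mul_assoc]

lemma V_mul_pow {d : ℕ} {g : (Fin n → ZMod r) → ZMod r} (hg : g ∈ V n r d) (j : Fin n) (m : ℕ) :
    (fun a => g a * a j ^ m) ∈ V n r (d + m) := by
  induction m with
  | zero => simpa using hg
  | succ m ih =>
    have h := V_mul ih j
    simp only [mul_assoc, ← pow_succ] at h
    exact h

lemma V_raise [Fact r.Prime] {d : ℕ} {g : (Fin n → ZMod r) → ZMod r} (hg : g ∈ V n r (d + 1)) :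
    g ∈ V n r (d + 1 + (r - 1)) := by
  have hr : r - 1 + 1 = r := Nat.sub_add_cancel (Fact.out : r.Prime).one_le
  have hg' := hg
  unfold V at hg
  induction hg using Submodule.span_induction with
  | mem x hx =>
    obtain ⟨w, rfl⟩ := hx
    convert V_mul_pow (Submodule.subset_span ⟨w, rfl⟩) (w 0) (r - 1) using 1
    funext a
    simp only [Fin.prod_univ_succ]
    have : a (w 0) ^ r = a (w 0) := ZMod.pow_card _
    have h2 : a (w 0) * a (w 0) ^ (r - 1) = a (w 0) := by
      rw [← pow_succ', hr, this]
    rw [mul_right_comm, h2]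
  | zero => exact Submodule.zero_mem _
  | add x y hx hy ihx ihy => exact Submodule.add_mem _ (ihx hx) (ihy hy)
  | smul c x hx ih => exact Submodule.smul_mem _ c (ih hx)

lemma V_raise' [Fact r.Prime] {m m' : ℕ} (h : m ≤ m') {g : (Fin n → ZMod r) → ZMod r}
    (hg : g ∈ V n r (m * (r - 1) + 1)) : g ∈ V n r (m' * (r - 1) + 1) := by
  induction m', h using Nat.le_induction with
  | base => exact hg
  | succ m' _ ih =>
    have := V_raise ih
    rwa [show m' * (r - 1) + 1 + (r - 1) = (m' + 1) * (r - 1) + 1 by ring] at this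

lemma V_prod [Fact r.Prime] (i : Fin n) (S : Finset (Fin n)) :
    (fun a => a i * ∏ j ∈ S, (1 - a j ^ (r - 1))) ∈ V n r (S.card * (r - 1) + 1) := by
  induction S using Finset.induction_on with
  | empty =>
    rw [Finset.card_empty, zero_mul, zero_add]
    refine Submodule.subset_span ⟨fun _ => i, ?_⟩
    funext a
    simp
  | insert j S hj ih =>
    rw [Finset.card_insert_of_notMem hj]
    have h1 := V_raise ih
    have h2 := V_mul_pow ih j (r - 1)
    have h3 := Submodule.sub_mem _ h1 h2
    rw [show S.card * (r - 1) + 1 + (r - 1) = (S.card + 1) * (r - 1) + 1 by ring] at h3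
    convert h3 using 1
    funext a
    simp only [Finset.prod_insert hj, Pi.sub_apply]
    ring

lemma exists_form [Fact r.Prime] (k : ℕ) (hbig : (n - 1) * (r - 1) < r ^ k) :
    ∃ c : (Fin (r ^ k) → Fin n) → ZMod r, ∀ a : Fin n → ZMod r, a ≠ 0 →
      ∑ w, c w * ∏ t, a (w t) ≠ 0 := by
  have hr : r.Prime := Fact.out
  obtain ⟨M, hM⟩ : ∃ M, r ^ k = M * (r - 1) + 1 := by
    have h := Nat.sub_dvd_pow_sub_pow r 1 k
    obtain ⟨M, hM⟩ := h
    have : 0 < r ^ k := pow_pos hr.pos k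
    refine ⟨M, ?_⟩
    rw [one_pow] at hM
    rw [mul_comm]
    omega
  have hMn : n - 1 ≤ M := by
    have : (n - 1) * (r - 1) ≤ M * (r - 1) := by omega
    exact Nat.le_of_mul_le_mul_right this (Nat.sub_pos_of_lt hr.one_lt)
  have hf : (fun a : Fin n → ZMod r => ∑ i, a i * ∏ j ∈ Finset.Iio i, (1 - a j ^ (r - 1)))
      ∈ V n r (r ^ k) := by
    rw [hM]
    have : (fun a : Fin n → ZMod r => ∑ i, a i * ∏ j ∈ Finset.Iio i, (1 - a j ^ (r - 1)))
      = ∑ i, fun a : Fin n → ZMod r => a i * ∏ j ∈ Finset.Iio i, (1 - a j ^ (r - 1)) := by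
      funext a
      simp
    rw [this]
    refine Submodule.sum_mem _ fun i _ => V_raise' (m := (Finset.Iio i).card) ?_ (V_prod i _)
    rw [Fin.card_Iio]
    have := i.2
    omega
  unfold V at hf
  rw [Submodule.mem_span_range_iff_exists_fun] at hf
  obtain ⟨c, hc⟩ := hf
  refine ⟨c, fun a ha => ?_⟩
  have h := congrFun hc a
  simp only [Finset.sum_apply, Pi.smul_apply, smul_eq_mul] at h
  rw [h]
  have hex : ∃ i, a i ≠ 0 := Function.ne_iff.mp ha
  obtain ⟨i, hi, hmin⟩ : ∃ i, a i ≠ 0 ∧ ∀ j, j < i → a j = 0 := by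
    obtain ⟨i, hi, hm⟩ := WellFounded.has_min (wellFounded_lt (α := Fin n)) {i | a i ≠ 0} hex
    exact ⟨i, hi, fun j hj => by
      by_contra h0
      exact hm j h0 hj⟩
  have hr1 : r - 1 ≠ 0 := Nat.sub_ne_zero_of_lt hr.one_lt
  rw [Finset.sum_eq_single i]
  · rw [Finset.prod_eq_one, mul_one]
    · exact hi
    · intro j hj
      rw [hmin j (Finset.mem_Iio.mp hj), zero_pow hr1, sub_zero]
  · intro j _ hji
    rcases lt_or_gt_of_ne hji with h' | h'
    · rw [hmin j h', zero_mul]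
    · rw [Finset.prod_eq_zero (Finset.mem_Iio.mpr h'), mul_zero]
      rw [ZMod.pow_card_sub_one_eq_one hi, sub_self]
  · simp

end poly

section mat
variable {N : ℕ} {R : Type} [CommRing R]

/-- Upper unitriangular with superdiagonal `s`. -/
structure Good (s : Fin N → R) (U : Matrix (Fin (N + 1)) (Fin (N + 1)) R) : Prop where
  low : ∀ i j, j < i → U i j = 0
  diag : ∀ i, U i i = 1
  sup : ∀ t : Fin N, U t.castSucc t.succ = s t

lemma Good.one : Good (0 : Fin N → R) 1 where
  low i j h := Matrix.one_apply_ne h.ne'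
  diag i := Matrix.one_apply_eq i
  sup t := Matrix.one_apply_ne (Fin.castSucc_lt_succ (i := t)).ne

lemma Good.mul {s s' : Fin N → R} {U U' : Matrix (Fin (N + 1)) (Fin (N + 1)) R}
    (h : Good s U) (h' : Good s' U') : Good (s + s') (U * U') where
  low i j hij := by
    rw [Matrix.mul_apply]
    refine Finset.sum_eq_zero fun l _ => ?_
    rcases lt_or_ge l i with hl | hl
    · rw [h.low i l hl, zero_mul]
    · rw [h'.low l j (hij.trans_le hl), mul_zero]
  diag i := by
    rw [Matrix.mul_apply, Finset.sum_eq_single i]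
    · rw [h.diag, h'.diag, one_mul]
    · intro l _ hl
      rcases lt_or_gt_of_ne hl with hl | hl
      · rw [h.low i l hl, zero_mul]
      · rw [h'.low l i hl, mul_zero]
    · simp
  sup t := by
    rw [Matrix.mul_apply, Fintype.sum_eq_add t.castSucc t.succ (Fin.castSucc_lt_succ (i := t)).ne]
    · rw [h.diag, h'.diag, h.sup, h'.sup, Pi.add_apply]
      ring
    · rintro l ⟨h1, h2⟩
      rcases lt_or_gt_of_ne h1 with hl | hl
      · rw [h.low _ l hl, zero_mul]
      · rw [h'.low l t.succ, mul_zero]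
        refine lt_of_le_of_ne ?_ (Ne.symm h2)
        simp only [Fin.lt_def, Fin.le_def, Fin.val_succ, Fin.val_castSucc] at hl ⊢
        omega

/-- The standard good matrix. -/
def std (s : Fin N → R) : Matrix (Fin (N + 1)) (Fin (N + 1)) R := fun i j =>
  if i = j then 1 else if h : i.1 < N ∧ j.1 = i.1 + 1 then s ⟨i.1, h.1⟩ else 0

lemma Good.std (s : Fin N → R) : Good s (std s) where
  low i j h := by
    rw [SpecialP.std, if_neg h.ne', dif_neg]
    rw [Fin.lt_def] at h
    omega
  diag i := by rw [SpecialP.std, if_pos rfl]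
  sup t := by
    rw [SpecialP.std, if_neg (Fin.castSucc_lt_succ (i := t)).ne, dif_pos (by simp)]
    rfl

lemma pow_low {M : Matrix (Fin (N + 1)) (Fin (N + 1)) R} (hM : ∀ i j, j ≤ i → M i j = 0)
    (m : ℕ) : ∀ i j : Fin (N + 1), j.1 < i.1 + m → (M ^ m) i j = 0 := by
  induction m with
  | zero =>
    intro i j h
    rw [pow_zero, Matrix.one_apply_ne]
    rintro rfl
    omega
  | succ m ih =>
    intro i j h
    rw [pow_succ, Matrix.mul_apply]
    refine Finset.sum_eq_zero fun l _ => ?_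
    rcases lt_or_ge l.1 (i.1 + m) with hl | hl
    · rw [ih i l hl, zero_mul]
    · rw [hM l j (by rw [Fin.le_def]; omega), mul_zero]

lemma pow_sup {M : Matrix (Fin (N + 1)) (Fin (N + 1)) R} (hM : ∀ i j, j ≤ i → M i j = 0)
    (m : ℕ) (hm : m ≤ N) : (M ^ m) 0 ⟨m, by omega⟩ =
      ∏ t : Fin m, M ⟨t.1, by omega⟩ ⟨t.1 + 1, by omega⟩ := by
  induction m with
  | zero => simp
  | succ m ih =>
    rw [pow_succ, Matrix.mul_apply, Finset.sum_eq_single ⟨m, by omega⟩, ih (by omega),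
      Fin.prod_univ_castSucc]
    · rfl
    · intro l _ hl
      rcases lt_or_ge l.1 m with h | h
      · rw [pow_low hM m 0 l (by simpa using h), zero_mul]
      · rw [hM, mul_zero]
        rw [Fin.le_def]
        have : l.1 ≠ m := fun h => hl (Fin.ext h)
        change m + 1 ≤ l.1
        omega
    · simp

lemma Good.sub_low {s : Fin N → R} {U : Matrix (Fin (N + 1)) (Fin (N + 1)) R}
    (h : Good s U) : ∀ i j, j ≤ i → (U - 1) i j = 0 := by
  intro i j hij
  rcases hij.lt_or_eq with h1 | rfl
  · rw [Matrix.sub_apply, h.low i j h1, Matrix.one_apply_ne h1.ne', sub_zero]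
  · rw [Matrix.sub_apply, h.diag, Matrix.one_apply_eq, sub_self]

/-- The elementary corner matrix. -/
def E (c : R) : Matrix (Fin (N + 1)) (Fin (N + 1)) R := Matrix.single 0 (Fin.last N) c

lemma Good.mul_E {s : Fin N → R} {U : Matrix (Fin (N + 1)) (Fin (N + 1)) R}
    (h : Good s U) (c : R) : U * E c = E c := by
  ext i j
  unfold E
  by_cases hj : j = Fin.last N
  · subst hj
    rw [Matrix.mul_single_apply_same]
    by_cases hi : i = 0
    · subst hi
      simp [h.diag]
    · rw [h.low i 0 (Fin.pos_of_ne_zero hi), zero_mul, Matrix.single_apply_of_row_ne (Ne.symm hi)]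
  · rw [Matrix.mul_single_apply_of_ne _ _ _ _ _ hj, Matrix.single_apply_of_col_ne _ _ (Ne.symm hj)]

lemma Good.E_mul {s : Fin N → R} {U : Matrix (Fin (N + 1)) (Fin (N + 1)) R}
    (h : Good s U) (c : R) : E c * U = E c := by
  ext i j
  unfold E
  by_cases hi : i = 0
  · subst hi
    rw [Matrix.single_mul_apply_same]
    by_cases hj : j = Fin.last N
    · subst hj
      simp [h.diag]
    · rw [h.low _ j (Fin.lt_last_iff_ne_last.mpr hj), mul_zero,
        Matrix.single_apply_of_col_ne _ _ (Ne.symm hj)]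
  · rw [Matrix.single_mul_apply_of_ne _ _ _ _ _ hi, Matrix.single_apply_of_row_ne (Ne.symm hi)]

lemma E_mul_E (hN : 0 < N) (c d : R) : (E c : Matrix (Fin (N + 1)) (Fin (N + 1)) R) * E d = 0 := by
  unfold E
  rw [Matrix.single_mul_single_of_ne]
  intro h
  have := congrArg Fin.val h
  simp at this
  omega

lemma one_add_E_apply (hN : 0 < N) (c : R) :
    (1 + E c : Matrix (Fin (N + 1)) (Fin (N + 1)) R) 0 (Fin.last N) = c := by
  have h : (0 : Fin (N + 1)) ≠ Fin.last N := by
    intro h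
    have := congrArg Fin.val h
    simp at this
    omega
  simp [E, h]

lemma Good.pow {r k : ℕ} [Fact r.Prime] [CharP R r] {s : Fin (r ^ k) → R}
    {U : Matrix (Fin (r ^ k + 1)) (Fin (r ^ k + 1)) R}
    (h : Good s U) : U ^ r ^ k = 1 + E (∏ t, s t) := by
  have hU : U = 1 + (U - 1) := by abel
  rw [hU, add_pow_char_pow_of_commute (p := r) (n := k) (Commute.one_left (U - 1)), one_pow]
  congr 1
  ext i j
  unfold E
  by_cases hij : i = 0 ∧ j = Fin.last _
  · obtain ⟨rfl, rfl⟩ := hij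
    rw [Matrix.single_apply_same]
    have := pow_sup h.sub_low (r ^ k) le_rfl
    refine this.trans (Finset.prod_congr rfl fun t _ => ?_)
    have h1 := h.sup t
    rw [Matrix.sub_apply, Matrix.one_apply_ne, sub_zero]
    · exact h1
    · intro h
      have := congrArg Fin.val h
      simp at this
  · rw [pow_low h.sub_low, Matrix.single_apply_of_ne]
    · tauto
    · by_contra hlt
      apply hij
      have h1 := i.2
      have h2 := j.2
      constructor
      · apply Fin.ext
        rw [Fin.val_zero]
        omega
      · apply Fin.ext
        rw [Fin.val_last]
        omega

lemma Good.pow_succ {r k : ℕ} [Fact r.Prime] [CharP R r] {s : Fin (r ^ k) → R}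
    {U : Matrix (Fin (r ^ k + 1)) (Fin (r ^ k + 1)) R}
    (h : Good s U) : U ^ r ^ (k + 1) = 1 := by
  have hr : r.Prime := Fact.out
  rw [_root_.pow_succ r, pow_mul, h.pow]
  have := add_pow_char_pow_of_commute (p := r) (n := 1)
    (Commute.one_left (E (∏ t, s t) : Matrix (Fin (r ^ k + 1)) (Fin (r ^ k + 1)) R))
  rw [pow_one, one_pow] at this
  rw [this]
  obtain ⟨q, hq⟩ := Nat.exists_eq_add_of_le hr.two_le
  have hz : ∀ m : ℕ, m = 2 + q →
      (E (∏ t, s t) : Matrix (Fin (r ^ k + 1)) (Fin (r ^ k + 1)) R) ^ m = 0 := by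
    intro m hm
    rw [hm, pow_add, pow_two (E _), E_mul_E (pow_pos hr.pos k), zero_mul]
  rw [hz r hq, add_zero]

end mat

section grp
variable (n r k : ℕ)

/-- The ambient group. -/
abbrev P : Type := Multiplicative (Fin n → ZMod r) ×
  ((Fin (r ^ k) → Fin n) → (Matrix (Fin (r ^ k + 1)) (Fin (r ^ k + 1)) (ZMod r))ˣ)

/-- The main subgroup, as a submonoid. -/
def GS : Submonoid (P n r k) where
  carrier := {g | ∀ w, Good (fun t => Multiplicative.toAdd g.1 (w t)) (g.2 w).1}
  one_mem' := fun _ => Good.one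
  mul_mem' := by
    intro a b ha hb w
    exact (ha w).mul (hb w)

/-- The central subgroup, as a submonoid. -/
def CS (hN : 0 < r ^ k) : Submonoid (P n r k) where
  carrier := {g | g.1 = 1 ∧ ∀ w, ∃ c, (g.2 w).1 = 1 + E c}
  one_mem' := ⟨rfl, fun _ => ⟨0, by simp [E]⟩⟩
  mul_mem' := by
    rintro a b ⟨ha, ha'⟩ ⟨hb, hb'⟩
    refine ⟨by simp [ha, hb], fun w => ?_⟩
    obtain ⟨c, hc⟩ := ha' w
    obtain ⟨d, hd⟩ := hb' w
    refine ⟨c + d, ?_⟩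
    change (a.2 w).1 * (b.2 w).1 = _
    rw [hc, hd, mul_add, add_mul, add_mul, E_mul_E hN, mul_one, mul_one, one_mul, add_zero, add_assoc]
    simp [E, Matrix.single_add]

end grp

end SpecialP


open SpecialP

/-- Proposition 9a: the special r-group quotient of the free group F_n. -/
theorem special_pgroup_free (n : ℕ) (hn : 1 ≤ n) (r : ℕ) (hr : r.Prime)
    (k : ℕ) (hk : 0 < k) (hbig : (n - 1) * (r - 1) < r ^ k) :
    ∃ (G : Type) (_ : Group G) (_ : Fintype G),
      (∃ j : ℕ, Fintype.card G = r ^ j) ∧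
      ∃ (C : Subgroup G) (ρ : FreeGroup (Fin n) →* G)
        (α : G →* Multiplicative (Fin n → ZMod r))
        (Ψ : ↥C →* Multiplicative (ZMod r)),
        C ≤ Subgroup.center G ∧
        α.comp ρ = freeModAb n r ∧
        ∀ g : G, α g ≠ 1 → ∃ h : g ^ r ^ k ∈ C, Ψ ⟨g ^ r ^ k, h⟩ ≠ 1 := by
  haveI : Fact r.Prime := ⟨hr⟩
  have hN : 0 < r ^ k := pow_pos hr.pos k
  obtain ⟨c, hc⟩ := exists_form (n := n) (r := r) k hbig
  let G : Subgroup (P n r k) := toSub (GS n r k)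
  let C : Subgroup G := (toSub (CS n r k hN)).comap G.subtype
  have hG : ∀ (g : G) (w), Good (fun t => Multiplicative.toAdd g.1.1 (w t)) (g.1.2 w).1 :=
    fun g => g.2
  have hC : ∀ (g : G), g ∈ C ↔ g.1.1 = 1 ∧ ∀ w, ∃ c, (g.1.2 w).1 = 1 + E c := fun g => Iff.rfl
  have hpow1 : ∀ g : G, (g ^ r ^ k).1.1 = 1 := by
    intro g
    change g.1.1 ^ r ^ k = 1
    apply Multiplicative.toAdd.injective
    rw [toAdd_pow, toAdd_one]
    funext i
    obtain ⟨k', rfl⟩ := Nat.exists_eq_succ_of_ne_zero hk.ne'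
    simp
  have hpow2 : ∀ (g : G) (w), ((g ^ r ^ k).1.2 w).1 =
      1 + E (∏ t, Multiplicative.toAdd g.1.1 (w t)) := by
    intro g w
    exact (hG g w).pow
  have hpC : ∀ g : G, g ^ r ^ k ∈ C := fun g => (hC _).2 ⟨hpow1 g, fun w => ⟨_, hpow2 g w⟩⟩
  letI : Fintype G := Fintype.ofFinite G
  refine ⟨G, inferInstance, inferInstance, ?_, C, ?_⟩
  · have hp : IsPGroup r G := by
      intro g
      refine ⟨k + 1, ?_⟩
      apply Subtype.ext
      apply Prod.ext
      · rw [pow_succ, pow_mul]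
        change ((g ^ r ^ k).1.1) ^ r = 1
        rw [hpow1, one_pow]
      · funext w
        apply Units.ext
        exact (hG g w).pow_succ
    obtain ⟨j, hj⟩ := IsPGroup.iff_card.mp hp
    exact ⟨j, by rw [← Nat.card_eq_fintype_card, hj]⟩
  let gen : Fin n → G := fun i => ⟨(Multiplicative.ofAdd (Pi.single i (1 : ZMod r)), fun w =>
    Units.ofPowEqOne (SpecialP.std fun t => (Pi.single i (1 : ZMod r) : Fin n → ZMod r) (w t))
      (r ^ (k + 1)) (Good.std _).pow_succ (pow_pos hr.pos _).ne'), fun w => Good.std _⟩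
  let Ψ : C →* Multiplicative (ZMod r) :=
    { toFun := fun g => Multiplicative.ofAdd (∑ w, c w * (g.1.1.2 w).1 0 (Fin.last _))
      map_one' := by
        have h : (0 : Fin (r ^ k + 1)) ≠ Fin.last _ := by
          intro h
          have := congrArg Fin.val h
          simp at this
          omega
        simp [h]
      map_mul' := by
        intro x y
        rw [← ofAdd_add, ← Finset.sum_add_distrib]
        congr 1
        refine Finset.sum_congr rfl fun w _ => ?_
        obtain ⟨a, ha⟩ := ((hC x.1).1 x.2).2 w
        obtain ⟨b, hb⟩ := ((hC y.1).1 y.2).2 w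
        change c w * ((x.1.1.2 w).1 * (y.1.1.2 w).1) 0 (Fin.last _) = _
        have : (1 + E a) * (1 + E b) = (1 + E (a + b) :
            Matrix (Fin (r ^ k + 1)) (Fin (r ^ k + 1)) (ZMod r)) := by
          rw [mul_add, add_mul, add_mul, E_mul_E hN, mul_one, mul_one, one_mul, add_zero, add_assoc]
          simp [E, Matrix.single_add]
        rw [ha, hb, this, one_add_E_apply hN, one_add_E_apply hN, one_add_E_apply hN, mul_add] }
  refine ⟨FreeGroup.lift gen, (MonoidHom.fst _ _).comp G.subtype, Ψ, ?_, ?_, ?_⟩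
  · intro x hx
    rw [Subgroup.mem_center_iff]
    intro g
    apply Subtype.ext
    apply Prod.ext
    · exact mul_comm _ _
    · funext w
      apply Units.ext
      obtain ⟨a, ha⟩ := ((hC x).1 hx).2 w
      change (g.1.2 w).1 * (x.1.2 w).1 = (x.1.2 w).1 * (g.1.2 w).1
      rw [ha, mul_add, add_mul, (hG g w).mul_E, (hG g w).E_mul, mul_one, one_mul]
  · ext i : 1
    simp [freeModAb, gen]
  · intro g hg
    refine ⟨hpC g, ?_⟩
    intro h
    have h' : ∑ w, c w * ((g ^ r ^ k).1.2 w).1 0 (Fin.last _) = 0 := h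
    refine hc (Multiplicative.toAdd g.1.1) (fun h0 => hg h0) ?_
    rw [← h']
    refine Finset.sum_congr rfl fun w _ => ?_
    rw [hpow2, one_add_E_apply hN]
end
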